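/- arXiv:math/0510386 — 3 statements merged into one kernel-verified Lean document; each statement's English description precedes it below -/
import Mathlib

section
/- The group F₂ × ℤ, the direct product of the free group on two generators with the infinite cyclic group, has rank exactly 3; that is, it can be generated by 3 elements but cannot be generated by 2 elements. -/
/-- A homomorphism from `G` to a vector space whose values span it bounds from below the
cardinality of every finite generating set of `G`. -/
theorem finrank_le_card_of_closure_eq_top {G K V : Type*} [Group G] [Field K] [AddCommGroup V]
    [Module K V] (f : G →* Multiplicative V)
    (hf : Submodule.span K (Set.range fun g => (f g).toAdd) = ⊤)
    (S : Finset G) (hS : Subgroup.closure (S : Set G) = ⊤) :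
    Module.finrank K V ≤ S.card := by
  classical
  have hmem : ∀ g, (f g).toAdd ∈ Submodule.span K
      (S.image fun g => (f g).toAdd : Set V) := by
    intro g
    have hg : g ∈ Subgroup.closure (S : Set G) := hS ▸ Subgroup.mem_top g
    induction hg using Subgroup.closure_induction with
    | mem x hx => exact Submodule.subset_span (Finset.mem_coe.2 (Finset.mem_image_of_mem _ hx))
    | one => simp
    | mul x y _ _ hx hy => simpa using Submodule.add_mem _ hx hy
    | inv x _ hx => simpa using hx
  have htop : Submodule.span K (S.image fun g => (f g).toAdd : Set V) = ⊤ := by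
    rw [eq_top_iff, ← hf, Submodule.span_le]
    rintro _ ⟨g, rfl⟩
    exact hmem g
  calc Module.finrank K V
      = Module.finrank K (Submodule.span K (S.image fun g => (f g).toAdd : Set V)) := by
        rw [htop, finrank_top]
    _ ≤ (S.image fun g => (f g).toAdd).card := finrank_span_finset_le_card _
    _ ≤ S.card := Finset.card_image_le

/-- The rationalized abelianization of `F₂ × ℤ`. -/
noncomputable def freeGroupProdIntToRat :
    FreeGroup (Fin 2) × Multiplicative ℤ →* Multiplicative (Fin 3 → ℚ) :=
  (FreeGroup.lift fun i => Multiplicative.ofAdd (Pi.single i.castSucc 1)).coprod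
    (zpowersHom _ (Multiplicative.ofAdd (Pi.single (Fin.last 2) 1)))

theorem span_range_freeGroupProdIntToRat :
    Submodule.span ℚ (Set.range fun g => (freeGroupProdIntToRat g).toAdd) = ⊤ := by
  rw [eq_top_iff, ← (Pi.basisFun ℚ (Fin 3)).span_eq]
  refine Submodule.span_mono ?_
  rintro _ ⟨i, rfl⟩
  induction i using Fin.lastCases with
  | last => exact ⟨(1, Multiplicative.ofAdd 1), by simp [freeGroupProdIntToRat]⟩
  | cast i => exact ⟨(FreeGroup.of i, 1), by simp [freeGroupProdIntToRat]⟩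

theorem closure_freeGroupProdInt_generators :
    Subgroup.closure ({(FreeGroup.of 0, 1), (FreeGroup.of 1, 1), (1, Multiplicative.ofAdd 1)} :
      Set (FreeGroup (Fin 2) × Multiplicative ℤ)) = ⊤ := by
  set H := Subgroup.closure ({(FreeGroup.of 0, 1), (FreeGroup.of 1, 1),
    (1, Multiplicative.ofAdd 1)} : Set (FreeGroup (Fin 2) × Multiplicative ℤ)) with hH
  have hl : ∀ w : FreeGroup (Fin 2), (w, (1 : Multiplicative ℤ)) ∈ H := by
    intro w
    have hw : w ∈ Subgroup.closure (Set.range (FreeGroup.of : Fin 2 → _)) := by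
      simp [FreeGroup.closure_range_of]
    have hle : Subgroup.closure (Set.range (FreeGroup.of : Fin 2 → _)) ≤
        H.comap (MonoidHom.inl _ _) := by
      rw [Subgroup.closure_le]
      rintro _ ⟨i, rfl⟩
      refine Subgroup.subset_closure ?_
      fin_cases i <;> simp
    exact hle hw
  have hr : ∀ z : Multiplicative ℤ, ((1 : FreeGroup (Fin 2)), z) ∈ H := by
    intro z
    have h : ((1 : FreeGroup (Fin 2)), Multiplicative.ofAdd (1 : ℤ)) ∈ H :=
      Subgroup.subset_closure (by simp)
    have hz : ((1 : FreeGroup (Fin 2)), z) = (1, Multiplicative.ofAdd (1 : ℤ)) ^ z.toAdd := by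
      rw [Prod.pow_mk, one_zpow, ← Int.ofAdd_mul, one_mul, ofAdd_toAdd]
    exact hz ▸ H.zpow_mem h _
  refine eq_top_iff.2 fun ⟨w, z⟩ _ => ?_
  simpa using H.mul_mem (hl w) (hr z)

/-- The group `F₂ × ℤ` has rank exactly 3: it can be generated by 3 elements
but cannot be generated by 2 elements. -/
theorem rank_F2_prod_Z_eq_three :
    (∃ S : Finset (FreeGroup (Fin 2) × Multiplicative ℤ),
        S.card = 3 ∧ Subgroup.closure (S : Set (FreeGroup (Fin 2) × Multiplicative ℤ)) = ⊤) ∧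
    (∀ S : Finset (FreeGroup (Fin 2) × Multiplicative ℤ),
        S.card ≤ 2 → Subgroup.closure (S : Set (FreeGroup (Fin 2) × Multiplicative ℤ)) ≠ ⊤) := by
  refine ⟨⟨{(FreeGroup.of 0, 1), (FreeGroup.of 1, 1), (1, Multiplicative.ofAdd 1)}, ?_, ?_⟩, ?_⟩
  · rw [Finset.card_eq_three]
    exact ⟨_, _, _, by simp [FreeGroup.of_injective.eq_iff], by simp, by simp, rfl⟩
  · simpa using closure_freeGroupProdInt_generators
  · intro S hcard hS
    have h := finrank_le_card_of_closure_eq_top freeGroupProdIntToRat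
      span_range_freeGroupProdIntToRat S hS
    rw [Module.finrank_fin_fun] at h
    omega
end

section
/- Let G be the amalgamated free product defined in the context. Then the quotient of G by the normal closure of the image of H in G is isomorphic to the free product ℤ² ∗ ℤ² of two copies of the free abelian group of rank 2. -/
/-- The commutator `c = x y x⁻¹ y⁻¹` of the generators of the free group on two
generators. -/
def commF2 : FreeGroup (Fin 2) :=
  FreeGroup.of (0 : Fin 2) * FreeGroup.of (1 : Fin 2) *
    (FreeGroup.of (0 : Fin 2))⁻¹ * (FreeGroup.of (1 : Fin 2))⁻¹

/-- The abelianization map `F₂ → ℤ²`, composed with the projection `F₂ × ℤ → F₂`. -/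
def prodToZ2 : FreeGroup (Fin 2) × Multiplicative ℤ →* Multiplicative (ℤ × ℤ) :=
  (FreeGroup.lift ![Multiplicative.ofAdd ((1 : ℤ), (0 : ℤ)), Multiplicative.ofAdd (0, 1)]).comp
    (MonoidHom.fst _ _)

@[simp]
lemma prodToZ2_of_zero (t : Multiplicative ℤ) :
    prodToZ2 (FreeGroup.of 0, t) = Multiplicative.ofAdd (1, 0) := by
  simp [prodToZ2]

@[simp]
lemma prodToZ2_of_one (t : Multiplicative ℤ) :
    prodToZ2 (FreeGroup.of 1, t) = Multiplicative.ofAdd (0, 1) := by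
  simp [prodToZ2]

lemma prodToZ2_commF2_zpow (k : ℤ) (t : Multiplicative ℤ) : prodToZ2 (commF2 ^ k, t) = 1 := by
  simp [prodToZ2, commF2]

/-- The homomorphism `ℤ² → K` determined by two commuting elements. -/
def Commute.zpowersHom₂ {K : Type*} [Group K] {a b : K} (h : Commute a b) :
    Multiplicative (ℤ × ℤ) →* K where
  toFun p := a ^ p.toAdd.1 * b ^ p.toAdd.2
  map_one' := by simp
  map_mul' p q := by
    simp only [toAdd_mul, Prod.fst_add, Prod.snd_add, zpow_add]
    exact ((h.symm.zpow_zpow _ _).mul_mul_mul_comm _ _).symm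

lemma monoidHom_multiplicative_int_prod_ext {K : Type*} [Group K]
    {f g : Multiplicative (ℤ × ℤ) →* K}
    (h₀ : f (Multiplicative.ofAdd (1, 0)) = g (Multiplicative.ofAdd (1, 0)))
    (h₁ : f (Multiplicative.ofAdd (0, 1)) = g (Multiplicative.ofAdd (0, 1))) : f = g := by
  refine MonoidHom.ext fun p => ?_
  have hp : p = Multiplicative.ofAdd ((1 : ℤ), (0 : ℤ)) ^ p.toAdd.1 *
      Multiplicative.ofAdd ((0 : ℤ), (1 : ℤ)) ^ p.toAdd.2 := by
    apply Multiplicative.toAdd.injective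
    ext <;> simp
  rw [hp, map_mul, map_mul, map_zpow, map_zpow, map_zpow, map_zpow, h₀, h₁]

/-- A homomorphism from `F₂ × ℤ` killing `c` and the second factor factors through `ℤ²`. -/
lemma exists_comp_prodToZ2_eq {K : Type*} [Group K]
    (g : FreeGroup (Fin 2) × Multiplicative ℤ →* K)
    (hc : g (commF2, 1) = 1) (ht : g (1, Multiplicative.ofAdd 1) = 1) :
    ∃ h : Multiplicative (ℤ × ℤ) →* K, h.comp prodToZ2 = g := by
  have hab : Commute (g (FreeGroup.of 0, 1)) (g (FreeGroup.of 1, 1)) := by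
    rw [← commutatorElement_eq_one_iff_commute, ← map_commutatorElement, ← hc]
    simp [commutatorElement_def, commF2]
  refine ⟨hab.zpowersHom₂, ?_⟩
  have hl : (hab.zpowersHom₂.comp prodToZ2).comp (MonoidHom.inl _ _) =
      g.comp (MonoidHom.inl _ _) := by
    ext i
    fin_cases i <;> simp [Commute.zpowersHom₂]
  have hr : (hab.zpowersHom₂.comp prodToZ2).comp (MonoidHom.inr _ _) =
      g.comp (MonoidHom.inr _ _) := by
    ext
    simp [ht, prodToZ2]
  refine MonoidHom.ext fun ⟨w, t⟩ => ?_
  have hwt : (w, t) = MonoidHom.inl (FreeGroup (Fin 2)) (Multiplicative ℤ) w *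
      MonoidHom.inr (FreeGroup (Fin 2)) (Multiplicative ℤ) t := by simp
  rw [hwt, map_mul, map_mul]
  exact congrArg₂ (· * ·) (DFunLike.congr_fun hl w) (DFunLike.congr_fun hr t)

lemma comp_prodToZ2_injective {K : Type*} [Group K] {f g : Multiplicative (ℤ × ℤ) →* K}
    (h : f.comp prodToZ2 = g.comp prodToZ2) : f = g :=
  monoidHom_multiplicative_int_prod_ext
    (by simpa using DFunLike.congr_fun h (FreeGroup.of 0, 1))
    (by simpa using DFunLike.congr_fun h (FreeGroup.of 1, 1))

/-- Let `G₁ = G₂ = F₂ × ℤ`, `H = ℤ × ℤ`, `φ₁(m,n) = (cᵐ, n)`, `φ₂(m,n) = (cⁿ, m)`, and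
let `G` be the pushout of `G₁` and `G₂` along `H` via `φ₁, φ₂` (expressed via its
universal property), with canonical maps `ι₁, ι₂`.  Then the quotient of `G` by the
normal closure of the image of `H` in `G` is isomorphic to `ℤ² ∗ ℤ²`. -/
theorem pushout_quot_image_eq_Z2_coprod_Z2 (G : Type) [Group G]
    (φ₁ φ₂ : Multiplicative (ℤ × ℤ) →* FreeGroup (Fin 2) × Multiplicative ℤ)
    (hφ₁ : ∀ m n : ℤ, φ₁ (Multiplicative.ofAdd (m, n)) = (commF2 ^ m, Multiplicative.ofAdd n))
    (hφ₂ : ∀ m n : ℤ, φ₂ (Multiplicative.ofAdd (m, n)) = (commF2 ^ n, Multiplicative.ofAdd m))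
    (ι₁ ι₂ : FreeGroup (Fin 2) × Multiplicative ℤ →* G)
    (hcomm : ι₁.comp φ₁ = ι₂.comp φ₂)
    (huniv : ∀ (K : Type) [Group K] (f₁ f₂ : FreeGroup (Fin 2) × Multiplicative ℤ →* K),
        f₁.comp φ₁ = f₂.comp φ₂ →
        ∃! f : G →* K, f.comp ι₁ = f₁ ∧ f.comp ι₂ = f₂) :
    Nonempty ((G ⧸ Subgroup.normalClosure (Set.range (ι₁.comp φ₁))) ≃*
      Monoid.Coprod (Multiplicative (ℤ × ℤ)) (Multiplicative (ℤ × ℤ))) := by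
  have hφ₁' (p) : prodToZ2 (φ₁ p) = 1 := by
    obtain ⟨m, n⟩ := p
    exact (congrArg _ (hφ₁ m n)).trans (prodToZ2_commF2_zpow _ _)
  have hφ₂' (p) : prodToZ2 (φ₂ p) = 1 := by
    obtain ⟨m, n⟩ := p
    exact (congrArg _ (hφ₂ m n)).trans (prodToZ2_commF2_zpow _ _)
  obtain ⟨f, ⟨hf₁, hf₂⟩, -⟩ := huniv
    (Monoid.Coprod (Multiplicative (ℤ × ℤ)) (Multiplicative (ℤ × ℤ)))
    (Monoid.Coprod.inl.comp prodToZ2) (Monoid.Coprod.inr.comp prodToZ2)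
    (MonoidHom.ext fun p => by simp [hφ₁', hφ₂'])
  set N := Subgroup.normalClosure (Set.range (ι₁.comp φ₁))
  have hker₁ (p) : QuotientGroup.mk' N (ι₁ (φ₁ p)) = 1 :=
    (QuotientGroup.eq_one_iff _).2 (Subgroup.subset_normalClosure ⟨p, rfl⟩)
  have hker₂ (p) : QuotientGroup.mk' N (ι₂ (φ₂ p)) = 1 := by
    rw [← hker₁ p]
    exact congrArg _ (DFunLike.congr_fun hcomm p).symm
  obtain ⟨g₁, hg₁⟩ := exists_comp_prodToZ2_eq ((QuotientGroup.mk' N).comp ι₁)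
    (by simpa [hφ₁] using hker₁ (Multiplicative.ofAdd (1, 0)))
    (by simpa [hφ₁] using hker₁ (Multiplicative.ofAdd (0, 1)))
  obtain ⟨g₂, hg₂⟩ := exists_comp_prodToZ2_eq ((QuotientGroup.mk' N).comp ι₂)
    (by simpa [hφ₂] using hker₂ (Multiplicative.ofAdd (0, 1)))
    (by simpa [hφ₂] using hker₂ (Multiplicative.ofAdd (1, 0)))
  have hle : N ≤ f.ker := by
    refine Subgroup.normalClosure_le_normal ?_
    rintro _ ⟨p, rfl⟩
    have := DFunLike.congr_fun hf₁ (φ₁ p)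
    simpa [hφ₁'] using this
  let F : G ⧸ N →* Monoid.Coprod (Multiplicative (ℤ × ℤ)) (Multiplicative (ℤ × ℤ)) :=
    QuotientGroup.lift N f hle
  have hF : F.comp (QuotientGroup.mk' N) = f := QuotientGroup.lift_comp_mk' N f hle
  refine ⟨MonoidHom.toMulEquiv F (Monoid.Coprod.lift g₁ g₂) ?_ ?_⟩
  · refine QuotientGroup.monoidHom_ext N ?_
    rw [MonoidHom.comp_assoc, hF, MonoidHom.id_comp]
    refine (huniv _ ((QuotientGroup.mk' N).comp ι₁) ((QuotientGroup.mk' N).comp ι₂)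
      (MonoidHom.ext fun p => (hker₁ p).trans (hker₂ p).symm)).unique ⟨?_, ?_⟩ ⟨rfl, rfl⟩
    · rw [MonoidHom.comp_assoc, hf₁, ← MonoidHom.comp_assoc, Monoid.Coprod.lift_comp_inl, hg₁]
    · rw [MonoidHom.comp_assoc, hf₂, ← MonoidHom.comp_assoc, Monoid.Coprod.lift_comp_inr, hg₂]
  · refine Monoid.Coprod.hom_ext (comp_prodToZ2_injective ?_) (comp_prodToZ2_injective ?_)
    · rw [MonoidHom.comp_assoc Monoid.Coprod.inl (Monoid.Coprod.lift g₁ g₂) F,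
        Monoid.Coprod.lift_comp_inl, MonoidHom.comp_assoc, hg₁,
        ← MonoidHom.comp_assoc, hF, hf₁, MonoidHom.id_comp]
    · rw [MonoidHom.comp_assoc Monoid.Coprod.inr (Monoid.Coprod.lift g₁ g₂) F,
        Monoid.Coprod.lift_comp_inr, MonoidHom.comp_assoc, hg₂,
        ← MonoidHom.comp_assoc, hF, hf₂, MonoidHom.id_comp]
end

section
/- Let n ≥ 0 and let C₀, C₁, …, Cₙ be nontrivial cyclic groups (each either infinite cyclic or finite cyclic of order at least 2). Then the free product C₀ ∗ C₁ ∗ ⋯ ∗ Cₙ has rank exactly n + 1; that is, its minimal number of generators is n + 1. -/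
/-- A nontrivial cyclic group has a nontrivial complex character. -/
theorem IsCyclic.exists_monoidHom_complex_units_ne_one (G : Type*) [Group G] [IsCyclic G]
    [Nontrivial G] : ∃ (χ : G →* ℂˣ) (g : G), χ g ≠ 1 := by
  let _ : CommGroup G := IsCyclic.commGroup
  cases finite_or_infinite G with
  | inl h =>
    obtain ⟨g, hg⟩ := exists_ne (1 : G)
    obtain ⟨χ, hχ⟩ := CommGroup.exists_apply_ne_one_of_hasEnoughRootsOfUnity G ℂ hg
    exact ⟨χ, g, hχ⟩
  | inr h =>
    obtain ⟨g, hg⟩ := IsCyclic.exists_generator (α := G)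
    let e := intEquivOfZPowersEqTop g ((Subgroup.eq_top_iff' _).2 hg)
    refine ⟨(zpowersHom ℂˣ (-1)).comp e.symm.toMonoidHom, e (Multiplicative.ofAdd 1), ?_⟩
    simp [Units.ext_iff]
    norm_num

namespace Monoid.CoprodI

/-- If each factor of a free product acts on `W` by homotheties, then every element of the free
product acts by an affine map with scalar linear part. -/
theorem exists_smul_add_of_homothety {ι k W : Type*} [Field k] [AddCommGroup W] [Module k W]
    {G : ι → Type*} [∀ i, Group (G i)] (χ : ∀ i, G i →* kˣ) (p : ι → W) (g : CoprodI G) :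
    ∃ c : kˣ, ∀ w, lift (fun i => (AffineEquiv.homothetyUnitsMulHom (p i)).comp (χ i)) g w =
      c • w + lift (fun i => (AffineEquiv.homothetyUnitsMulHom (p i)).comp (χ i)) g 0 := by
  induction g using induction_on with
  | one => exact ⟨1, by simp⟩
  | of i x =>
    refine ⟨χ i x, fun w => ?_⟩
    simp [AffineMap.homothety_apply, Units.smul_def, smul_sub]
    abel
  | mul x y hx hy =>
    obtain ⟨a, ha⟩ := hx
    obtain ⟨b, hb⟩ := hy
    refine ⟨a * b, fun w => ?_⟩
    simp only [map_mul, AffineEquiv.mul_def, AffineEquiv.trans_apply]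
    rw [hb, ha, ha (lift (fun i => (AffineEquiv.homothetyUnitsMulHom (p i)).comp (χ i)) y 0),
      smul_add, mul_smul, add_assoc]

/-- If each factor of a free product has a nontrivial character with values in a field, then a
generating set has at least as many elements as there are factors. -/
theorem card_le_card_of_closure_eq_top {ι k : Type*} [Fintype ι] [Field k]
    {G : ι → Type*} [∀ i, Group (G i)] (χ : ∀ i, G i →* kˣ) (hχ : ∀ i, ∃ g, χ i g ≠ 1)
    (S : Finset (CoprodI G)) (hS : Subgroup.closure (S : Set (CoprodI G)) = ⊤) :
    Fintype.card ι ≤ S.card := by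
  classical
  let p : ι → (ι → k) := fun i => Pi.single i 1
  let φ := lift (fun i => (AffineEquiv.homothetyUnitsMulHom (p i)).comp (χ i))
  let T : Finset (ι → k) := S.image fun s => φ s 0
  let U := Submodule.span k (T : Set (ι → k))
  have hU (g : CoprodI G) : ∀ w, φ g w ∈ U ↔ w ∈ U := by
    have hg : g ∈ Subgroup.closure (S : Set (CoprodI G)) := hS ▸ Subgroup.mem_top g
    induction hg using Subgroup.closure_induction with
    | mem s hs =>
      intro w
      obtain ⟨c, hc⟩ := exists_smul_add_of_homothety χ p s
      have h0 : φ s 0 ∈ U := Submodule.subset_span (Finset.mem_image_of_mem _ hs)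
      rw [show φ s w = c • w + φ s 0 from hc w, U.add_mem_iff_left h0]
      exact U.smul_mem_iff' c
    | one => simp
    | mul x y _ _ hx hy => intro w; simp [AffineEquiv.mul_def, hx, hy]
    | inv x _ hx =>
      intro w
      rw [← hx, map_inv, AffineEquiv.inv_def, AffineEquiv.apply_symm_apply]
  have htop : U = ⊤ := by
    rw [eq_top_iff, ← (Pi.basisFun k ι).span_eq, Submodule.span_le]
    rintro _ ⟨i, rfl⟩
    obtain ⟨x, hx⟩ := hχ i
    have h1 := (hU (of x) 0).2 U.zero_mem
    have h2 : φ (of x) 0 = (1 - (χ i x : k)) • p i := by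
      simp [φ, AffineMap.homothety_apply, sub_smul]
      abel
    rw [h2, U.smul_mem_iff (sub_ne_zero.2 fun h : (1 : k) = χ i x => hx (Units.ext h.symm))] at h1
    simpa [p] using h1
  calc Fintype.card ι = Module.finrank k U := by rw [htop, finrank_top, Module.finrank_pi]
    _ ≤ T.card := finrank_span_finset_le_card T
    _ ≤ S.card := Finset.card_image_le

/-- A free product of cyclic groups is generated by any choice of generators of its factors. -/
theorem closure_range_of_eq_top {ι : Type*} {G : ι → Type*} [∀ i, Group (G i)] (g : ∀ i, G i)
    (hg : ∀ i x, x ∈ Subgroup.zpowers (g i)) :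
    Subgroup.closure (Set.range fun i => (of (g i) : CoprodI G)) = ⊤ := by
  refine (Subgroup.eq_top_iff' _).2 fun x => ?_
  induction x using induction_on with
  | one => exact one_mem _
  | of i x =>
    obtain ⟨m, rfl⟩ := hg i x
    simpa using zpow_mem (Subgroup.subset_closure (Set.mem_range_self i)) m
  | mul x y hx hy => exact mul_mem hx hy

end Monoid.CoprodI

/-- The free product of `n + 1` nontrivial cyclic groups has rank exactly `n + 1`:
it can be generated by `n + 1` elements, and any generating set has at least
`n + 1` elements. -/
theorem rank_coprodI_cyclic (n : ℕ) (C : Fin (n + 1) → Type)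
    [∀ i, Group (C i)] [∀ i, IsCyclic (C i)] [∀ i, Nontrivial (C i)] :
    (∃ S : Finset (Monoid.CoprodI C),
        S.card = n + 1 ∧ Subgroup.closure (S : Set (Monoid.CoprodI C)) = ⊤) ∧
    (∀ S : Finset (Monoid.CoprodI C),
        Subgroup.closure (S : Set (Monoid.CoprodI C)) = ⊤ → n + 1 ≤ S.card) := by
  classical
  have lower (S : Finset (Monoid.CoprodI C))
      (hS : Subgroup.closure (S : Set (Monoid.CoprodI C)) = ⊤) : n + 1 ≤ S.card := by
    choose χ hχ using fun i => IsCyclic.exists_monoidHom_complex_units_ne_one (C i)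
    simpa using Monoid.CoprodI.card_le_card_of_closure_eq_top χ hχ S hS
  choose g hg using fun i => IsCyclic.exists_generator (α := C i)
  let S : Finset (Monoid.CoprodI C) := Finset.univ.image fun i => Monoid.CoprodI.of (g i)
  have hS : Subgroup.closure (S : Set (Monoid.CoprodI C)) = ⊤ := by
    simpa [S] using Monoid.CoprodI.closure_range_of_eq_top g hg
  exact ⟨⟨S, le_antisymm (Finset.card_image_le.trans (by simp)) (lower S hS), hS⟩, lower⟩
end
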